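/- Let p ≥ 5 be a prime and let D be a nontrivial regular (v,k,λ,μ)-partial difference set in an Abelian group of order v = 8p^3 with Δ = (λ−μ)^2 + 4(k−μ) = 4p^2 and k ≤ v/2 = 4p^3. Then 4k ≤ 4p^2 + p − 2 (equivalently, k ≤ p^2 + p/4 − 1/2). -/

import Mathlib

variable {G : Type*} [CommGroup G] [DecidableEq G] [Fintype G]

/-- The number of representations of `g` as `d₁ * d₂⁻¹` with `d₁, d₂ ∈ D`, `d₁ ≠ d₂`. -/
def pdsReps (D : Finset G) (g : G) : ℕ :=
  ((D ×ˢ D).filter (fun x => x.1 ≠ x.2 ∧ x.1 * x.2⁻¹ = g)).card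

/-- `D` is a `(v,k,λ,μ)`-partial difference set in `G`. -/
def IsPDS (D : Finset G) (v k l m : ℕ) : Prop :=
  Fintype.card G = v ∧ D.card = k ∧
  (∀ g : G, g ≠ 1 → g ∈ D → pdsReps D g = l) ∧
  (∀ g : G, g ≠ 1 → g ∉ D → pdsReps D g = m)

/-- `D` is regular: closed under inverses and not containing the identity. -/
def IsRegularPDS (D : Finset G) : Prop :=
  (∀ d ∈ D, d⁻¹ ∈ D) ∧ (1 : G) ∉ D

/-- A regular PDS is trivial if `D ∪ {e}` or `G \ D` is a subgroup. -/
def IsTrivialPDS (D : Finset G) : Prop :=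
  (∃ H : Subgroup G, (H : Set G) = ↑D ∪ {1}) ∨
  (∃ H : Subgroup G, (H : Set G) = (↑D : Set G)ᶜ)

/-- Counting the ordered pairs of distinct elements of `D` by their quotient. -/
theorem sum_pdsReps {G : Type*} [CommGroup G] [DecidableEq G] [Fintype G] (D : Finset G) :
    ∑ g : G, pdsReps D g = D.card * D.card - D.card := by
  have h := Finset.card_eq_sum_card_fiberwise (s := D.offDiag) (t := Finset.univ)
    (f := fun x : G × G => x.1 * x.2⁻¹) (fun _ _ => Finset.mem_coe.2 (Finset.mem_univ _))
  rw [Finset.offDiag_card] at h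
  rw [h]
  refine Finset.sum_congr rfl fun g _ => ?_
  unfold pdsReps
  congr 1
  ext x
  simp only [Finset.mem_filter, Finset.mem_product, Finset.mem_offDiag]
  tauto

theorem pdsReps_one {G : Type*} [CommGroup G] [DecidableEq G] [Fintype G] (D : Finset G) :
    pdsReps D 1 = 0 := by
  unfold pdsReps
  rw [Finset.card_eq_zero, Finset.filter_eq_empty_iff]
  rintro x - ⟨hne, h⟩
  exact hne (mul_inv_eq_one.1 h)

/-- The standard parameter identity of a partial difference set not containing the identity. -/
theorem IsPDS.card_identity {G : Type*} [CommGroup G] [DecidableEq G] [Fintype G]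
    {D : Finset G} {v k l m : ℕ} (h : IsPDS D v k l m) (h1 : (1 : G) ∉ D) :
    (k : ℤ) * k = k + k * l + (v - 1 - k) * m := by
  obtain ⟨hv, hk, hl, hm⟩ := h
  have hsum := sum_pdsReps D
  have hDl : ∑ g ∈ D, pdsReps D g = k * l := by
    rw [Finset.sum_congr rfl fun g hg => hl g (fun h => h1 (h ▸ hg)) hg, Finset.sum_const, hk,
      smul_eq_mul]
  have hcompl : (1 : G) ∈ Dᶜ := Finset.mem_compl.2 h1
  have hDm : ∑ g ∈ Dᶜ.erase 1, pdsReps D g = (Dᶜ.erase 1).card * m := by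
    rw [Finset.sum_congr rfl fun g hg => hm g (Finset.ne_of_mem_erase hg)
      (Finset.mem_compl.1 (Finset.mem_of_mem_erase hg)), Finset.sum_const, smul_eq_mul]
  have hcard : (Dᶜ.erase 1).card + 1 + k = v := by
    rw [Finset.card_erase_add_one hcompl, ← hk, ← hv, Finset.card_compl_add_card]
  rw [← Finset.sum_add_sum_compl D, ← Finset.add_sum_erase _ _ hcompl, pdsReps_one, hDl, hDm,
    hk] at hsum
  have hle : k ≤ k * k := Nat.le_mul_self k
  have hsum' : k * k = k + k * l + (Dᶜ.erase 1).card * m := by omega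
  have hcard' : (v : ℤ) - 1 - k = ((Dᶜ.erase 1).card : ℤ) := by
    rw [← hcard]; push_cast; ring
  rw [hcard']
  exact_mod_cast hsum'

/-- The arithmetic consequence of the parameter identities, where `b = (λ - μ) / 2`. -/
theorem pds_arith_bound {p k m b : ℤ} (hp : Prime p) (hp5 : 5 ≤ p) (hk : k ≤ 4 * p ^ 3)
    (hb : b ^ 2 + (k - m) = p ^ 2) (hmk : m ≤ k)
    (h : (k - b) ^ 2 = 8 * p ^ 3 * m + p ^ 2) : k ≤ p ^ 2 := by
  have hdvd : p ∣ k - b := hp.dvd_of_dvd_pow (n := 2) ⟨8 * p ^ 2 * m + p, by rw [h]; ring⟩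
  obtain ⟨t, ht⟩ := hdvd
  have hp0 : 0 < p := by linarith
  have ht2 : t ^ 2 = 8 * p * m + 1 := by
    have : p ^ 2 * t ^ 2 = p ^ 2 * (8 * p * m + 1) := by rw [ht] at h; linarith
    exact mul_left_cancel₀ (by positivity) this
  have hbp : |b| ≤ p := abs_le_of_sq_le_sq (by linarith) hp0.le
  obtain ⟨hb1, hb2⟩ := abs_le.1 hbp
  have hm : m = b * (b + 1) + p * t - p ^ 2 := by linarith
  have hbb : 0 ≤ b * (b + 1) := by
    rcases le_or_gt 0 b with h0 | h0
    · positivity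
    · exact mul_nonneg_of_nonpos_of_nonpos h0.le (by linarith)
  have htle : t ≤ p := by
    by_contra! hlt
    have hupper : t ≤ 4 * p ^ 2 + 1 := by
      refine le_of_mul_le_mul_left ?_ hp0
      linarith
    have hquad : 0 ≤ t ^ 2 - 8 * p ^ 2 * t + 8 * p ^ 3 - 1 := by
      have : t ^ 2 - 8 * p ^ 2 * t + 8 * p ^ 3 - 1 = 8 * p * (b * (b + 1)) := by
        rw [ht2, hm]; ring
      rw [this]; positivity
    nlinarith [mul_nonneg (sub_nonneg.2 hlt) (sub_nonneg.2 hupper)]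
  have htne : t ≠ p := by
    rintro rfl
    exact hp.not_dvd_one ⟨t - 8 * m, by linarith⟩
  have htlt : t ≤ p - 1 := by
    have := lt_of_le_of_ne htle htne
    omega
  nlinarith

/-- For a nontrivial regular PDS in an Abelian group of order `8p^3` with
`Δ = 4p^2` and `k ≤ 4p^3`, `p ≥ 5` prime, we have `k ≤ p^2 + p/4 - 1/2`. -/
theorem pds_delta_4p2_k_bound (p : ℕ) (hp : p.Prime) (hp5 : 5 ≤ p)
    {G : Type*} [CommGroup G] [DecidableEq G] [Fintype G]
    (D : Finset G) (k l m : ℕ)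
    (hPDS : IsPDS D (8 * p ^ 3) k l m) (hreg : IsRegularPDS D)
    (hnt : ¬ IsTrivialPDS D) (hk : k ≤ 4 * p ^ 3)
    (hΔ : ((l : ℤ) - m) ^ 2 + 4 * ((k : ℤ) - m) = 4 * p ^ 2) :
    4 * k ≤ 4 * p ^ 2 + p - 2 := by
  have hcount := hPDS.card_identity hreg.2
  push_cast at hcount
  have hp5' : (5 : ℤ) ≤ p := by exact_mod_cast hp5
  have hk' : (k : ℤ) ≤ 4 * (p : ℤ) ^ 3 := by exact_mod_cast hk
  have hkp : (k : ℤ) ≤ (p : ℤ) ^ 2 := by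
    rcases le_or_gt k 1 with hk1 | hk1
    · have : (k : ℤ) ≤ 1 := by exact_mod_cast hk1
      nlinarith
    have hk1' : (1 : ℤ) < k := by exact_mod_cast hk1
    have hmk : (m : ℤ) ≤ k := by
      have hm0 : (0 : ℤ) ≤ m := by positivity
      have hkl : (0 : ℤ) ≤ k * l := by positivity
      have : (m : ℤ) * (k - 1) ≤ k * (k - 1) := by nlinarith
      exact le_of_mul_le_mul_right this (by linarith)
    have heven : Even ((l : ℤ) - m) := by
      have : Even (((l : ℤ) - m) ^ 2) := ⟨2 * ((p : ℤ) ^ 2 - (k - m)), by linarith⟩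
      exact (Int.even_pow.1 this).1
    obtain ⟨b, hb⟩ := heven
    have hl : (l : ℤ) = m + 2 * b := by linarith
    rw [hl] at hcount hΔ
    have hbb : b ^ 2 + ((k : ℤ) - m) = (p : ℤ) ^ 2 := by linarith
    exact pds_arith_bound (Nat.prime_iff_prime_int.1 hp) hp5' hk' hbb hmk (by linarith)
  have hkp' : k ≤ p ^ 2 := by exact_mod_cast hkp
  omega
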